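/- Let O be the ring of germs of holomorphic functions at a point o′ of a complex manifold of dimension n with maximal ideal 𝔪, let μ: (z_1,…,z_n) ↦ (w_1,…,w_n) be a holomorphic map germ whose Jacobian determinant det(∂w_i/∂z_j) has order r = ord_{o′} det(J) < ∞. Then for every holomorphic germ g at μ(o′), ord_{o′}(g ∘ μ) ≤ (r + 1) · ord_0(g). -/

import Mathlib

open Filter Topology Asymptotics in
lemma tg_lead {E F : Type*} [NormedAddCommGroup E] [NormedSpace ℂ E]
    [NormedAddCommGroup F] [NormedSpace ℂ F] [CompleteSpace F]
    {f : E → F} {x : E} (hf : AnalyticAt ℂ f x) (m : ℕ)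
    (hm : ∀ j < m, iteratedFDeriv ℂ j f x = 0) :
    (fun y => f (x + y)) =O[𝓝 0] (fun y => ‖y‖ ^ m) ∧
    ∃ q : ContinuousMultilinearMap ℂ (fun _ : Fin m => E) F,
      (fun y => f (x + y) - q (fun _ => y)) =O[𝓝 0] (fun y => ‖y‖ ^ (m + 1)) ∧
      (iteratedFDeriv ℂ m f x ≠ 0 → ∃ v, q (fun _ => v) ≠ 0) := by
  obtain ⟨p, hp⟩ := hf
  obtain ⟨R, hR⟩ := id hp
  have hz : ∀ j < m, ∀ y, p j (fun _ => y) = 0 := by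
    intro j hj y
    have h1 := hR.factorial_smul y j
    rw [hm j hj] at h1
    rw [← Nat.cast_smul_eq_nsmul ℂ] at h1
    simpa [Nat.factorial_ne_zero] using h1
  have hps : ∀ y, p.partialSum m y = 0 := by
    intro y
    exact Finset.sum_eq_zero fun j hj => hz j (Finset.mem_range.1 hj) y
  refine ⟨?_, p m, ?_, ?_⟩
  · have := hp.isBigO_sub_partialSum_pow m
    simpa [hps] using this
  · have := hp.isBigO_sub_partialSum_pow (m + 1)
    refine this.congr_left fun y => ?_
    have : p.partialSum (m + 1) y = p.partialSum m y + p m (fun _ => y) := by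
      simp [FormalMultilinearSeries.partialSum, Finset.sum_range_succ]
    rw [this, hps, zero_add]
  · intro hne
    by_contra! hcon
    apply hne
    ext v
    rw [hR.iteratedFDeriv_eq_sum_of_completeSpace,
      ← ContinuousMultilinearMap.iteratedFDeriv_comp_diagonal (p m) x v]
    have : (fun x => p m (fun _ => x)) = fun _ : E => (0 : F) := funext hcon
    rw [this]
    simp

lemma tg_diag {E : Type*} [NormedAddCommGroup E] [NormedSpace ℂ E] {a b : ℕ}
    (q₁ : ContinuousMultilinearMap ℂ (fun _ : Fin a => E) ℂ)
    (q₂ : ContinuousMultilinearMap ℂ (fun _ : Fin b => E) ℂ)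
    (h₁ : ∃ v, q₁ (fun _ => v) ≠ 0) (h₂ : ∃ v, q₂ (fun _ => v) ≠ 0) :
    ∃ v, q₁ (fun _ => v) ≠ 0 ∧ q₂ (fun _ => v) ≠ 0 := by
  obtain ⟨v₁, h₁⟩ := h₁
  obtain ⟨v₂, h₂⟩ := h₂
  by_contra! hcon
  have key : ∀ {c : ℕ} (q : ContinuousMultilinearMap ℂ (fun _ : Fin c => E) ℂ),
      AnalyticOnNhd ℂ (fun t : ℂ => q (fun _ => v₁ + t • (v₂ - v₁))) Set.univ := by
    intro c q
    apply DifferentiableOn.analyticOnNhd _ isOpen_univ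
    apply Differentiable.differentiableOn
    have hq : Differentiable ℂ q := (q.contDiff (n := 1)).differentiable (by simp)
    have h2 : Differentiable ℂ (fun t : ℂ => (fun _ : Fin c => v₁ + t • (v₂ - v₁))) := by
      fun_prop
    exact hq.comp h2
  rcases AnalyticOnNhd.eq_zero_or_eq_zero_of_mul_eq_zero (key q₁) (key q₂)
    (fun t _ => by
      by_cases h : q₁ (fun _ => v₁ + t • (v₂ - v₁)) = 0
      · rw [h, zero_mul]
      · rw [hcon _ h, mul_zero]) isPreconnected_univ with h | h
  · exact h₁ (by simpa using h 0 trivial)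
  · exact h₂ (by simpa using h 1 trivial)

open Filter Topology Asymptotics in
lemma tg_cancel {E : Type*} [NormedAddCommGroup E] [NormedSpace ℂ E]
    {D h : E → ℂ} {x : E} (hD : AnalyticAt ℂ D x) (hh : AnalyticAt ℂ h x) (r k : ℕ)
    (hr : iteratedFDeriv ℂ r D x ≠ 0) (hlt : ∀ j < r, iteratedFDeriv ℂ j D x = 0)
    (hO : (fun y => D (x + y) * h (x + y)) =O[𝓝 0] (fun y => ‖y‖ ^ (k + r))) :
    ∀ m < k, iteratedFDeriv ℂ m h x = 0 := by
  intro m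
  induction m using Nat.strong_induction_on with
  | _ m ih =>
    intro hmk
    by_contra hne
    obtain ⟨-, q₁, hq₁, hv₁⟩ := tg_lead hD r hlt
    obtain ⟨hhO, q₂, hq₂, hv₂⟩ := tg_lead hh m (fun j hj => ih j hj (hj.trans hmk))
    obtain ⟨v, hv1, hv2⟩ := tg_diag q₁ q₂ (hv₁ hr) (hv₂ hne)
    have hO' : (fun y => D (x + y) * h (x + y)) =O[𝓝 0] (fun y : E => ‖y‖ ^ (m + r + 1)) := by
      refine hO.trans ?_
      refine IsBigO.of_bound 1 ?_
      filter_upwards [Metric.ball_mem_nhds (0 : E) one_pos] with y hy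
      have : ‖y‖ ≤ 1 := by simpa using (mem_ball_zero_iff.1 hy).le
      simp only [norm_pow, norm_norm, one_mul]
      exact pow_le_pow_of_le_one (norm_nonneg _) this (by omega)
    have hq1O : (fun y => q₁ (fun _ => y)) =O[𝓝 0] (fun y : E => ‖y‖ ^ r) := by
      refine IsBigO.of_bound ‖q₁‖ (Eventually.of_forall fun y => ?_)
      have := q₁.le_opNorm (fun _ => y)
      simpa using this
    have hprod : (fun y => q₁ (fun _ => y) * q₂ (fun _ => y)) =O[𝓝 0]
        (fun y : E => ‖y‖ ^ (m + r + 1)) := by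
      have e1 := (hq₁.mul hhO).congr_right (g₂ := fun y : E => ‖y‖ ^ (m + r + 1))
        (fun y => by ring)
      have e2 := (hq1O.mul hq₂).congr_right (g₂ := fun y : E => ‖y‖ ^ (m + r + 1))
        (fun y => by ring)
      exact ((hO'.sub e1).sub e2).congr_left fun y => by ring
    have ht : Tendsto (fun t : ℂ => t • v) (𝓝 0) (𝓝 0) := by
      have : Continuous (fun t : ℂ => t • v) := by fun_prop
      simpa using this.tendsto 0
    have hline := hprod.comp_tendsto ht
    have hl2 : (fun t : ℂ => t ^ (m + r) * (q₁ (fun _ => v) * q₂ (fun _ => v))) =O[𝓝 0]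
        (fun t : ℂ => t ^ (m + r + 1)) := by
      have a1 : (fun t : ℂ => t ^ (m + r) * (q₁ (fun _ => v) * q₂ (fun _ => v))) =O[𝓝 0]
          (fun t : ℂ => ‖t • v‖ ^ (m + r + 1)) := by
        refine hline.congr_left fun t => ?_
        have b1 := q₁.map_smul_univ (fun _ => t) (fun _ => v)
        have b2 := q₂.map_smul_univ (fun _ => t) (fun _ => v)
        simp only [Finset.prod_const, Finset.card_univ, Fintype.card_fin, smul_eq_mul] at b1 b2
        simp only [Function.comp, b1, b2]
        ring
      refine a1.trans (IsBigO.of_bound (‖v‖ ^ (m + r + 1)) (Eventually.of_forall fun t => ?_))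
      simp only [norm_pow, norm_norm, norm_smul, mul_pow]
      rw [mul_comm, Real.norm_of_nonneg (by positivity)]
    have hlo : (fun t : ℂ => t ^ (m + r + 1)) =o[𝓝 0] (fun t : ℂ => t ^ (m + r)) :=
      isLittleO_pow_pow (by omega)
    have h3 := hl2.trans_isLittleO hlo
    have h4 : (fun t : ℂ => t ^ (m + r)) =o[𝓝 0] (fun t : ℂ => t ^ (m + r)) := by
      have := h3.mul_isBigO (isBigO_refl (fun _ : ℂ => (q₁ (fun _ => v) * q₂ (fun _ => v))⁻¹) (𝓝 0))
      have h5 := (isLittleO_const_mul_right_iff (inv_ne_zero (mul_ne_zero hv1 hv2))).1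
        (this.congr_right (fun t => mul_comm _ _))
      refine h5.congr_left fun t => ?_
      field_simp
    have h6 := (h4.mono (nhdsWithin_le_nhds (s := {0}ᶜ))).def (show (0 : ℝ) < 1 / 2 by norm_num)
    obtain ⟨t, h7, h8⟩ := (h6.and self_mem_nhdsWithin).exists
    have h9 : 0 < ‖t ^ (m + r)‖ := norm_pos_iff.2 (pow_ne_zero _ h8)
    linarith

lemma tg_det_analytic {n : ℕ} {μ : (Fin n → ℂ) → (Fin n → ℂ)} {o' : Fin n → ℂ}
    (hμ : AnalyticAt ℂ μ o') :
    AnalyticAt ℂ (fun z => LinearMap.det ((fderiv ℂ μ z).toLinearMap)) o' := by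
  have : (fun z => LinearMap.det ((fderiv ℂ μ z).toLinearMap)) = fun z =>
      ∑ σ : Equiv.Perm (Fin n), ((Equiv.Perm.sign σ : ℤ) : ℂ) *
        ∏ i, (fderiv ℂ μ z (Pi.single i 1)) (σ i) := by
    funext z
    rw [← LinearMap.det_toMatrix', Matrix.det_apply']
    simp [LinearMap.toMatrix'_apply]
  rw [this]
  have e : ∀ i j, AnalyticAt ℂ (fun z => (fderiv ℂ μ z (Pi.single i 1)) j) o' := by
    intro i j
    let L : ((Fin n → ℂ) →L[ℂ] (Fin n → ℂ)) →L[ℂ] ℂ :=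
      (ContinuousLinearMap.proj (R := ℂ) (φ := fun _ : Fin n => ℂ) j).comp (ContinuousLinearMap.apply ℂ (Fin n → ℂ) (Pi.single i 1))
    exact (L.analyticAt _).comp hμ.fderiv
  refine Finset.analyticAt_fun_sum _ fun σ _ => ?_
  exact analyticAt_const.mul (Finset.analyticAt_fun_prod _ fun i _ => e _ _)

open Filter Topology Asymptotics in
lemma tg_main (n : ℕ)
    (μ : (Fin n → ℂ) → (Fin n → ℂ)) (o' : Fin n → ℂ)
    (hμ : AnalyticAt ℂ μ o') (r : ℕ)
    (hJr : iteratedFDeriv ℂ r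
        (fun z => LinearMap.det ((fderiv ℂ μ z).toLinearMap)) o' ≠ 0)
    (hJlt : ∀ j < r, iteratedFDeriv ℂ j
        (fun z => LinearMap.det ((fderiv ℂ μ z).toLinearMap)) o' = 0)
    (p : ℕ) : ∀ (g : (Fin n → ℂ) → ℂ), AnalyticAt ℂ g (μ o') →
      (∀ j ≤ (r + 1) * p, iteratedFDeriv ℂ j (g ∘ μ) o' = 0) →
      ∀ j ≤ p, iteratedFDeriv ℂ j g (μ o') = 0 := by
  induction p with
  | zero =>
    intro g hg h j hj
    obtain rfl : j = 0 := by omega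
    have h0 := h 0 (by omega)
    ext v
    have := congrArg (fun q => q 0) h0
    simpa using this
  | succ p ih =>
    intro g hg h j hj
    have hcomp : AnalyticAt ℂ (g ∘ μ) o' := hg.comp hμ
    have hdir : ∀ v : Fin n → ℂ, ∀ j ≤ p,
        iteratedFDeriv ℂ j (fun w => fderiv ℂ g w v) (μ o') = 0 := by
      intro v
      have hgv : AnalyticAt ℂ (fun w => fderiv ℂ g w v) (μ o') :=
        ((ContinuousLinearMap.apply ℂ ℂ v).analyticAt _).comp hg.fderiv
      refine ih _ hgv ?_
      have hO := (tg_lead hcomp.fderiv ((r + 1) * (p + 1)) (fun j hj => by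
        rw [← norm_eq_zero, norm_iteratedFDeriv_fderiv, norm_eq_zero]
        exact h _ hj)).1
      let u : (Fin n → ℂ) → (Fin n → ℂ) := fun z =>
        Matrix.mulVec (Matrix.adjugate (LinearMap.toMatrix' (fderiv ℂ μ z).toLinearMap)) v
      have hu : ContinuousAt u o' := by
        have hA : Continuous (fun L : (Fin n → ℂ) →L[ℂ] (Fin n → ℂ) =>
            LinearMap.toMatrix' L.toLinearMap) := by
          refine continuous_matrix fun i j => ?_
          simp only [LinearMap.toMatrix'_apply]
          have hc : Continuous (fun L : (Fin n → ℂ) →L[ℂ] (Fin n → ℂ) =>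
              L (Pi.single j (1 : ℂ)) i) := by fun_prop
          exact hc
        have hB : Continuous (fun L : (Fin n → ℂ) →L[ℂ] (Fin n → ℂ) =>
            Matrix.mulVec (Matrix.adjugate (LinearMap.toMatrix' L.toLinearMap)) v) :=
          hA.matrix_adjugate.matrix_mulVec continuous_const
        exact hB.continuousAt.comp hμ.fderiv.continuousAt
      have htr : Tendsto (fun y => o' + y) (𝓝 0) (𝓝 o') := by
        have : Continuous (fun y => o' + y) := by fun_prop
        simpa using this.tendsto 0
      have huO : (fun y => u (o' + y)) =O[𝓝 0] (fun _ => (1 : ℝ)) :=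
        (hu.tendsto.comp htr).isBigO_one ℝ
      have hprod : (fun y => fderiv ℂ (g ∘ μ) (o' + y) (u (o' + y))) =O[𝓝 0]
          (fun y => ‖y‖ ^ ((r + 1) * (p + 1))) := by
        have := hO.norm_left.mul huO.norm_left
        simp only [mul_one] at this
        refine IsBigO.trans (IsBigO.of_bound 1 (Eventually.of_forall fun y => ?_)) this
        simpa using (fderiv ℂ (g ∘ μ) (o' + y)).le_opNorm (u (o' + y))
      have hev : ∀ᶠ y in 𝓝 (0 : Fin n → ℂ), fderiv ℂ (g ∘ μ) (o' + y) (u (o' + y)) =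
          LinearMap.det ((fderiv ℂ μ (o' + y)).toLinearMap) *
            ((fun w => fderiv ℂ g w v) ∘ μ) (o' + y) := by
        have e1 := htr.eventually hμ.eventually_analyticAt
        have e2 := htr.eventually (hμ.continuousAt.eventually hg.eventually_analyticAt)
        filter_upwards [e1, e2] with y h1 h2
        rw [fderiv_comp _ h2.differentiableAt h1.differentiableAt]
        have : fderiv ℂ μ (o' + y) (u (o' + y)) =
            LinearMap.det ((fderiv ℂ μ (o' + y)).toLinearMap) • v := by
          have a : (fderiv ℂ μ (o' + y)) (u (o' + y)) = Matrix.mulVec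
            (LinearMap.toMatrix' (fderiv ℂ μ (o' + y)).toLinearMap) (u (o' + y)) := by
            rw [LinearMap.toMatrix'_mulVec]; rfl
          rw [a, Matrix.mulVec_mulVec, Matrix.mul_adjugate, Matrix.smul_mulVec, Matrix.one_mulVec,
            LinearMap.det_toMatrix']
        simp [this]
      intro j hj
      refine tg_cancel (tg_det_analytic hμ) (hgv.comp hμ) r ((r + 1) * p + 1) hJr hJlt ?_ j
        (by omega)
      have e : (r + 1) * p + 1 + r = (r + 1) * (p + 1) := by ring
      rw [e]
      exact hprod.congr' hev EventuallyEq.rfl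
    rcases j with _ | j
    · have h0 := h 0 (by omega)
      ext v
      have := congrArg (fun q => q 0) h0
      simpa using this
    · ext m
      rw [iteratedFDeriv_succ_apply_right]
      have h1 := hdir (m (Fin.last j)) j (by omega)
      have h2 := (ContinuousLinearMap.apply ℂ ℂ (m (Fin.last j))).iteratedFDeriv_comp_left
        (hg.fderiv.contDiffAt (n := j)) (i := j) le_rfl
      have h3 : iteratedFDeriv ℂ j (fun w => fderiv ℂ g w (m (Fin.last j))) (μ o') = _ := h2
      rw [h1] at h3
      have := congrArg (fun q => q (Fin.init m)) h3
      simpa using this.symm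

/-- Tougeron's lemma: let `μ` be a holomorphic map germ at `o'` between
`n`-dimensional complex spaces whose Jacobian determinant `det J` has finite
order of vanishing `r` at `o'` (the iterated derivatives of `det J` at `o'` of
order `< r` vanish and the `r`-th does not). If `g` is holomorphic at `μ o'`
with order of vanishing (at most) `p` (its `p`-th iterated derivative at `μ o'`
is nonzero), then `ord_{o'}(g ∘ μ) ≤ (r + 1) · p`, i.e. some iterated derivative
of `g ∘ μ` at `o'` of order `≤ (r+1)·p` is nonzero. -/
theorem stmt_15 (n : ℕ) (hn : 1 ≤ n)
    (μ : (Fin n → ℂ) → (Fin n → ℂ)) (o' : Fin n → ℂ)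
    (hμ : AnalyticAt ℂ μ o') (r : ℕ)
    (hJr : iteratedFDeriv ℂ r
        (fun z => LinearMap.det ((fderiv ℂ μ z).toLinearMap)) o' ≠ 0)
    (hJlt : ∀ j < r, iteratedFDeriv ℂ j
        (fun z => LinearMap.det ((fderiv ℂ μ z).toLinearMap)) o' = 0)
    (g : (Fin n → ℂ) → ℂ) (hg : AnalyticAt ℂ g (μ o')) (p : ℕ)
    (hgp : iteratedFDeriv ℂ p g (μ o') ≠ 0)
    (hglt : ∀ j < p, iteratedFDeriv ℂ j g (μ o') = 0) :
    ∃ j ≤ (r + 1) * p, iteratedFDeriv ℂ j (g ∘ μ) o' ≠ 0 := by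
  by_contra! hcon
  exact hgp (tg_main n μ o' hμ r hJr hJlt p g hg hcon p le_rfl)
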